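/- Assume Γ is Q-polynomial with respect to E. Then the Krein parameter q^1_{1,1} satisfies q^1_{1,1} = (θ₁ θ*_1 − θ₂ θ*_0 + θ₂ − θ₀) / (θ₁ − θ₂). -/

import Mathlib

open Matrix Finset
open scoped Classical

/-- A distance-regular graph `Γ` with vertex set `X`, path-length distance
`G.dist`, diameter `d ≥ 2`, and intersection numbers `p h i j`. -/
structure DRG where
  X : Type
  [fin : Fintype X]
  [deceq : DecidableEq X]
  G : SimpleGraph X
  conn : G.Connected
  d : ℕ
  d_ge_two : 2 ≤ d
  dist_le : ∀ x y : X, G.dist x y ≤ d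
  dist_attained : ∃ x y : X, G.dist x y = d
  p : ℕ → ℕ → ℕ → ℕ
  dist_regular : ∀ (h i j : ℕ) (x y : X), G.dist x y = h →
    (Finset.univ.filter fun z => G.dist x z = i ∧ G.dist y z = j).card = p h i j

attribute [instance] DRG.fin DRG.deceq

namespace DRG

variable (Γ : DRG)

/-- `Γ_i(x) = {z : ∂(x,z) = i}`. -/
noncomputable def sphere (x : Γ.X) (i : ℕ) : Finset Γ.X :=
  Finset.univ.filter fun z => Γ.G.dist x z = i

/-- The number of vertices `|X|`, as a real number. -/
noncomputable def n : ℝ := (Fintype.card Γ.X : ℝ)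

/-- The `i`-th distance matrix `A_i`. -/
noncomputable def Ai (i : ℕ) : Matrix Γ.X Γ.X ℝ :=
  Matrix.of fun x y => if Γ.G.dist x y = i then (1 : ℝ) else 0

/-- The adjacency matrix `A = A_1`. -/
noncomputable def A : Matrix Γ.X Γ.X ℝ := Γ.Ai 1

/-- The all-ones matrix `J`. -/
def Jmat : Matrix Γ.X Γ.X ℝ := Matrix.of fun _ _ => (1 : ℝ)

/-- `c_i = p^i_{1,i-1}` (so `c_0 = 0`). -/
noncomputable def c (i : ℕ) : ℝ := (Γ.p i 1 (i - 1) : ℝ)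

/-- `a_i = p^i_{1,i}`. -/
noncomputable def a (i : ℕ) : ℝ := (Γ.p i 1 i : ℝ)

/-- `b_i = p^i_{1,i+1}` (so `b_d = 0`). -/
noncomputable def b (i : ℕ) : ℝ := (Γ.p i 1 (i + 1) : ℝ)

/-- The standard basis vector `x̂`. -/
noncomputable def hatv (x : Γ.X) : Γ.X → ℝ := Pi.single x 1

/-- `x⁺_y = Σ_{z ∈ Γ(x) ∩ Γ_{i+1}(y)} ẑ` where `i = ∂(x,y)`. -/
noncomputable def plusv (x y : Γ.X) : Γ.X → ℝ :=
  ∑ z ∈ Γ.sphere x 1 ∩ Γ.sphere y (Γ.G.dist x y + 1), Γ.hatv z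

/-- `x⁰_y = Σ_{z ∈ Γ(x) ∩ Γ_i(y)} ẑ` where `i = ∂(x,y)`. -/
noncomputable def zerov (x y : Γ.X) : Γ.X → ℝ :=
  ∑ z ∈ Γ.sphere x 1 ∩ Γ.sphere y (Γ.G.dist x y), Γ.hatv z

/-- `x⁻_y = Σ_{z ∈ Γ(x) ∩ Γ_{i-1}(y)} ẑ` where `i = ∂(x,y)`
(for `i = 0` this is the zero vector, matching `Γ_{-1}(y) = ∅`). -/
noncomputable def minusv (x y : Γ.X) : Γ.X → ℝ :=
  ∑ z ∈ Γ.sphere x 1 ∩ Γ.sphere y (Γ.G.dist x y - 1), Γ.hatv z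

/-- The Norton product `u ⋆ v = E (u ∘ v)`, where `∘` is the entrywise
(Hadamard) product of vectors. -/
noncomputable def norton (E : Matrix Γ.X Γ.X ℝ) (u v : Γ.X → ℝ) : Γ.X → ℝ :=
  E *ᵥ (u * v)

/-- `E 0, …, E d` is the sequence of primitive idempotents of the Bose–Mesner
algebra, with `E 0 = |X|⁻¹ J`, and `θ 0, …, θ d` are the corresponding
(mutually distinct) eigenvalues, so that `A = Σ_i θ i • E i`. -/
def IsPrimIdemSeq (E : ℕ → Matrix Γ.X Γ.X ℝ) (θ : ℕ → ℝ) : Prop :=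
  E 0 = (Γ.n)⁻¹ • Γ.Jmat ∧
  ∑ i ∈ Finset.range (Γ.d + 1), E i = 1 ∧
  (∀ i j : ℕ, i ≤ Γ.d → j ≤ Γ.d → E i * E j = if i = j then E i else 0) ∧
  Γ.A = ∑ i ∈ Finset.range (Γ.d + 1), θ i • E i ∧
  (∀ i j : ℕ, i ≤ Γ.d → j ≤ Γ.d → θ i = θ j → i = j)

/-- `q h i j` are the Krein parameters:
`E i ∘ E j = |X|⁻¹ Σ_h q h i j • E h`, with `∘` the entrywise product. -/
def IsKrein (E : ℕ → Matrix Γ.X Γ.X ℝ) (q : ℕ → ℕ → ℕ → ℝ) : Prop :=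
  ∀ i j : ℕ, i ≤ Γ.d → j ≤ Γ.d →
    Matrix.hadamard (E i) (E j) =
      (Γ.n)⁻¹ • ∑ h ∈ Finset.range (Γ.d + 1), q h i j • E h

/-- The ordering `E 1, …, E d` is `Q`-polynomial: for `0 ≤ h,i,j ≤ d`,
`q h i j = 0` if one of `h,i,j` is greater than the sum of the other two, and
`q h i j ≠ 0` if one of `h,i,j` equals the sum of the other two. -/
def IsQPolynomial (q : ℕ → ℕ → ℕ → ℝ) : Prop :=
  ∀ h i j : ℕ, h ≤ Γ.d → i ≤ Γ.d → j ≤ Γ.d →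
    ((i + j < h ∨ h + j < i ∨ h + i < j) → q h i j = 0) ∧
    ((h = i + j ∨ i = h + j ∨ j = h + i) → q h i j ≠ 0)

/-- `ts 0, …, ts d` are the (mutually distinct) dual eigenvalues associated
with `E`, i.e. `E = |X|⁻¹ Σ_i ts i • A i`.  The values `ts (-1)` and
`ts (d+1)` are arbitrary reals (indeterminates). -/
def IsDualEigs (E : Matrix Γ.X Γ.X ℝ) (ts : ℤ → ℝ) : Prop :=
  E = (Γ.n)⁻¹ • ∑ i ∈ Finset.range (Γ.d + 1), ts i • Γ.Ai i

/-- The dual eigenvalues `ts 0, …, ts d` are mutually distinct. -/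
def DualDistinct (ts : ℤ → ℝ) : Prop :=
  ∀ i j : ℕ, i ≤ Γ.d → j ≤ Γ.d → ts i = ts j → i = j

/-- `C(x,y) = E x⁻_y − c_i ((θ*_1 − θ*_{i-1})/(θ*_0 − θ*_i)) E x̂`,
where `i = ∂(x,y)`. -/
noncomputable def Cvec (E : Matrix Γ.X Γ.X ℝ) (ts : ℤ → ℝ) (x y : Γ.X) :
    Γ.X → ℝ :=
  E *ᵥ Γ.minusv x y -
    (Γ.c (Γ.G.dist x y) *
      ((ts 1 - ts ((Γ.G.dist x y : ℤ) - 1)) / (ts 0 - ts (Γ.G.dist x y)))) •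
      (E *ᵥ Γ.hatv x)

/-- `B(x,y) = E x⁺_y − b_i ((θ*_1 − θ*_{i+1})/(θ*_0 − θ*_i)) E x̂`,
where `i = ∂(x,y)`. -/
noncomputable def Bvec (E : Matrix Γ.X Γ.X ℝ) (ts : ℤ → ℝ) (x y : Γ.X) :
    Γ.X → ℝ :=
  E *ᵥ Γ.plusv x y -
    (Γ.b (Γ.G.dist x y) *
      ((ts 1 - ts ((Γ.G.dist x y : ℤ) + 1)) / (ts 0 - ts (Γ.G.dist x y)))) •
      (E *ᵥ Γ.hatv x)

end DRG

namespace DRG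

variable {Γ : DRG} {E : ℕ → Matrix Γ.X Γ.X ℝ} {θ : ℕ → ℝ}

theorem n_pos : 0 < Γ.n := by
  have : Nonempty Γ.X := Γ.conn.nonempty
  exact Nat.cast_pos.mpr Fintype.card_pos

theorem IsDualEigs.apply {F : Matrix Γ.X Γ.X ℝ} {ts : ℤ → ℝ} (h : Γ.IsDualEigs F ts)
    (x y : Γ.X) : F x y = Γ.n⁻¹ * ts (Γ.G.dist x y) := by
  have hlt : Γ.G.dist x y < Γ.d + 1 := Nat.lt_succ_of_le (Γ.dist_le x y)
  rw [h]
  simp [Matrix.sum_apply, Ai, hlt]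

/-- The adjacency matrix acts on `E j` as the scalar `θ j`. -/
theorem IsPrimIdemSeq.A_mul (hE : Γ.IsPrimIdemSeq E θ) {j : ℕ} (hj : j ≤ Γ.d) :
    Γ.A * E j = θ j • E j := by
  obtain ⟨-, -, hmul, hA, -⟩ := hE
  rw [hA, Finset.sum_mul, Finset.sum_eq_single j]
  · rw [smul_mul_assoc, hmul j j hj hj, if_pos rfl]
  · intro i hi hij
    rw [smul_mul_assoc, hmul i j (Nat.lt_succ_iff.mp (Finset.mem_range.mp hi)) hj,
      if_neg hij, smul_zero]
  · intro h
    exact absurd (Finset.mem_range.mpr (Nat.lt_succ_of_le hj)) h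

/-- A diagonal entry of `A F`, when `F` is constant on pairs of adjacent vertices. -/
theorem A_mul_apply_self {F : Matrix Γ.X Γ.X ℝ} {r : ℝ}
    (hF : ∀ x y, Γ.G.dist x y = 1 → F y x = r) (x : Γ.X) :
    (Γ.A * F) x x = (Γ.sphere x 1).card * r := by
  have h (z : Γ.X) : Γ.A x z * F z x = if Γ.G.dist x z = 1 then r else 0 := by
    by_cases hz : Γ.G.dist x z = 1
    · rw [hF x z hz, A, Ai, Matrix.of_apply, if_pos hz, if_pos hz, one_mul]
    · rw [A, Ai, Matrix.of_apply, if_neg hz, if_neg hz, zero_mul]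
  simp only [Matrix.mul_apply, h]
  rw [← Finset.sum_filter, Finset.sum_const, nsmul_eq_mul, sphere]

theorem IsDualEigs.sum_sq (hE : Γ.IsPrimIdemSeq E θ) {ts : ℤ → ℝ}
    (hts : Γ.IsDualEigs (E 1) ts) (x : Γ.X) : ∑ z, E 1 x z ^ 2 = Γ.n⁻¹ * ts 0 := by
  have h1 : 1 ≤ Γ.d := one_le_two.trans Γ.d_ge_two
  have h := congrFun (congrFun (hE.2.2.1 1 1 h1 h1) x) x
  rw [if_pos rfl, Matrix.mul_apply, hts.apply x x, SimpleGraph.dist_self] at h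
  rw [← Nat.cast_zero, ← h]
  refine Finset.sum_congr rfl fun z _ => ?_
  rw [hts.apply z x, hts.apply x z, SimpleGraph.dist_comm, sq]

theorem IsDualEigs.ts_zero_ne_zero (hE : Γ.IsPrimIdemSeq E θ) {ts : ℤ → ℝ}
    (hts : Γ.IsDualEigs (E 1) ts) (hts' : Γ.DualDistinct ts) : ts 0 ≠ 0 := by
  intro h0
  obtain ⟨x, y, hxy⟩ := Γ.dist_attained
  have hs := hts.sum_sq hE x
  rw [h0, mul_zero, Finset.sum_eq_zero_iff_of_nonneg fun z _ => sq_nonneg _] at hs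
  have hy := pow_eq_zero_iff two_ne_zero |>.mp (hs y (Finset.mem_univ y))
  rw [hts.apply x y, hxy, mul_eq_zero, or_iff_right (inv_ne_zero n_pos.ne')] at hy
  have := hts' Γ.d 0 le_rfl (Nat.zero_le _) (by simpa [h0] using hy)
  have := Γ.d_ge_two
  omega

theorem IsKrein.hadamard_one_one {q : ℕ → ℕ → ℕ → ℝ} (hq : Γ.IsKrein E q)
    (hQ : Γ.IsQPolynomial q) :
    Matrix.hadamard (E 1) (E 1) =
      Γ.n⁻¹ • (q 0 1 1 • E 0 + q 1 1 1 • E 1 + q 2 1 1 • E 2) := by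
  have h2 := Γ.d_ge_two
  have h1 : 1 ≤ Γ.d := one_le_two.trans h2
  have hsub : Finset.range 3 ⊆ Finset.range (Γ.d + 1) :=
    Finset.range_subset_range.mpr (by omega)
  rw [hq 1 1 h1 h1, ← Finset.sum_subset hsub, Finset.sum_range_succ, Finset.sum_range_succ,
    Finset.sum_range_one]
  intro h hh hh'
  rw [Finset.mem_range] at hh hh'
  rw [(hQ h 1 1 (by omega) h1 h1).1 (by omega), zero_smul]

theorem IsKrein.q_zero_one_one (hE : Γ.IsPrimIdemSeq E θ) {q : ℕ → ℕ → ℕ → ℝ}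
    (hq : Γ.IsKrein E q) (hQ : Γ.IsQPolynomial q) {ts : ℤ → ℝ}
    (hts : Γ.IsDualEigs (E 1) ts) : q 0 1 1 = ts 0 := by
  have h2 := Γ.d_ge_two
  have h1 : 1 ≤ Γ.d := one_le_two.trans h2
  obtain ⟨x⟩ := Γ.conn.nonempty
  have hn := Γ.n_pos.ne'
  have hm : Matrix.hadamard (E 1) (E 1) * E 0 = Γ.n⁻¹ • q 0 1 1 • E 0 := by
    rw [hq.hadamard_one_one hQ]
    simp [add_mul, hE.2.2.1 0 0 (Nat.zero_le _) (Nat.zero_le _),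
      hE.2.2.1 1 0 h1 (Nat.zero_le _), hE.2.2.1 2 0 h2 (Nat.zero_le _)]
  have h := congrFun (congrFun hm x) x
  simp only [Matrix.mul_apply, Matrix.hadamard_apply, Matrix.smul_apply, hE.1, Jmat,
    Matrix.of_apply, smul_eq_mul, mul_one, ← Finset.sum_mul, ← sq] at h
  rw [hts.sum_sq hE x] at h
  field_simp at h
  exact h.symm

end DRG

/-- Corollary 3.9: a formula for the Krein parameter `q¹₁₁`. -/
theorem DRG.krein_q111_formula (Γ : DRG) (E : ℕ → Matrix Γ.X Γ.X ℝ) (θ : ℕ → ℝ)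
    (hE : Γ.IsPrimIdemSeq E θ)
    (q : ℕ → ℕ → ℕ → ℝ) (hq : Γ.IsKrein E q) (hQ : Γ.IsQPolynomial q)
    (ts : ℤ → ℝ) (hts : Γ.IsDualEigs (E 1) ts) (hts' : Γ.DualDistinct ts) :
    q 1 1 1 = (θ 1 * ts 1 - θ 2 * ts 0 + θ 2 - θ 0) / (θ 1 - θ 2) := by
  have h2 := Γ.d_ge_two
  have h1 : 1 ≤ Γ.d := one_le_two.trans h2
  obtain ⟨x⟩ := Γ.conn.nonempty
  have hn := Γ.n_pos.ne'
  have hθ : θ 1 - θ 2 ≠ 0 := fun h =>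
    absurd (hE.2.2.2.2 1 2 h1 h2 (sub_eq_zero.mp h)) (by norm_num)
  have h0 := hts.ts_zero_ne_zero hE hts'
  have hadj (y z : Γ.X) (h : Γ.G.dist y z = 1) : E 1 z y = Γ.n⁻¹ * ts 1 := by
    rw [hts.apply, SimpleGraph.dist_comm, h, Nat.cast_one]
  have hxx : E 1 x x = Γ.n⁻¹ * ts 0 := by
    rw [hts.apply, SimpleGraph.dist_self, Nat.cast_zero]
  have h0xx : E 0 x x = Γ.n⁻¹ := by simp [hE.1, DRG.Jmat]
  have hA0 : (Γ.sphere x 1).card * Γ.n⁻¹ = θ 0 * Γ.n⁻¹ := by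
    rw [← DRG.A_mul_apply_self (F := E 0) (fun y z _ => by simp [hE.1, DRG.Jmat]) x,
      hE.A_mul (Nat.zero_le _), Matrix.smul_apply, h0xx, smul_eq_mul]
  have hA1 : (Γ.sphere x 1).card * (Γ.n⁻¹ * ts 1) = θ 1 * (Γ.n⁻¹ * ts 0) := by
    rw [← DRG.A_mul_apply_self hadj x, hE.A_mul h1, Matrix.smul_apply, hxx, smul_eq_mul]
  have hH := hq.hadamard_one_one hQ
  rw [hq.q_zero_one_one hE hQ hts] at hH
  have hd := congrFun (congrFun hH x) x
  have hAH : (Γ.sphere x 1).card * (Γ.n⁻¹ * ts 1 * (Γ.n⁻¹ * ts 1)) =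
      Γ.n⁻¹ * (ts 0 * (θ 0 * E 0 x x) + q 1 1 1 * (θ 1 * E 1 x x)
        + q 2 1 1 * (θ 2 * E 2 x x)) := by
    rw [← DRG.A_mul_apply_self (F := Matrix.hadamard (E 1) (E 1))
      (fun y z h => by rw [Matrix.hadamard_apply, hadj y z h]) x, hH]
    simp [mul_add, hE.A_mul (Nat.zero_le _), hE.A_mul h1, hE.A_mul h2]
  simp only [Matrix.hadamard_apply, Matrix.smul_apply, Matrix.add_apply, smul_eq_mul] at hd
  rw [hxx, h0xx] at hd hAH
  field_simp at hd hAH hA0 hA1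
  rw [hA0] at hA1 hAH
  rw [eq_div_iff hθ]
  apply mul_left_cancel₀ h0
  linear_combination θ 2 * hd + ts 1 * hA1 - hAH
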